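/- Let I ⊆ K[X][U] be an ideal and ≺ an I-specific elimination order for U. Then GB(I,≺) ∩ K[X] is the normed reduced Gröbner basis of the elimination ideal I ∩ K[X] with respect to the restriction of ≺ to monomials in K[X]. -/

import Mathlib

open MvPolynomial

/-- A monomial order on exponent vectors in `Fin N →₀ ℕ`:
a linear order compatible with addition in which `0` is the least element. -/
structure MonoOrder (N : ℕ) where
  lt : (Fin N →₀ ℕ) → (Fin N →₀ ℕ) → Prop
  total : ∀ a b, a = b ∨ lt a b ∨ lt b a
  trans : ∀ a b c, lt a b → lt b c → lt a c
  irrefl : ∀ a, ¬ lt a a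
  add_right : ∀ a b c, lt a b → lt (a + c) (b + c)
  zero_lt : ∀ a, a ≠ 0 → lt 0 a

variable {N : ℕ} {K : Type*} [Field K]

/-- The ω-degree `ω · d` of an exponent vector `d`. -/
noncomputable def wdeg (ω : Fin N → ℝ) (d : Fin N → ℕ) : ℝ :=
  ∑ i, ω i * (d i : ℝ)

/-- The ≺-maximal exponent in the support of `p` (the exponent of the leading term). -/
noncomputable def leadExp (mo : MonoOrder N) (p : MvPolynomial (Fin N) K) : Fin N →₀ ℕ :=
  open Classical in
  if h : ∃ d ∈ p.support, ∀ e ∈ p.support, e ≠ d → mo.lt e d then h.choose else 0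

/-- The leading term `lt_≺(p)` of `p` w.r.t. the monomial order `mo`. -/
noncomputable def leadTerm (mo : MonoOrder N) (p : MvPolynomial (Fin N) K) :
    MvPolynomial (Fin N) K :=
  monomial (leadExp mo p) (p.coeff (leadExp mo p))

/-- `p ∈ K[X]`: the polynomial `p` involves only the first `n` variables. -/
def inKX (n : ℕ) (p : MvPolynomial (Fin N) K) : Prop :=
  ∀ d ∈ p.support, ∀ i : Fin N, n ≤ (i : ℕ) → d i = 0

open Classical in
/-- Initial form `lt_ω(p)`: the sum of the terms of `p` of maximal ω-degree. -/
noncomputable def initForm (ω : Fin N → ℝ) (p : MvPolynomial (Fin N) K) :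
    MvPolynomial (Fin N) K :=
  ∑ d ∈ p.support.filter (fun d : Fin N →₀ ℕ => ∀ e ∈ p.support, wdeg ω ⇑e ≤ wdeg ω ⇑d),
    monomial d (p.coeff d)

/-- The initial ideal `⟨lt_ω(I)⟩` w.r.t. a weight vector ω. -/
noncomputable def ltIdealW (ω : Fin N → ℝ) (I : Ideal (MvPolynomial (Fin N) K)) :
    Ideal (MvPolynomial (Fin N) K) :=
  Ideal.span (initForm ω '' (I : Set (MvPolynomial (Fin N) K)))

/-- The initial ideal `⟨lt_≺(I)⟩` w.r.t. a monomial order. -/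
noncomputable def ltIdealO (mo : MonoOrder N) (I : Ideal (MvPolynomial (Fin N) K)) :
    Ideal (MvPolynomial (Fin N) K) :=
  Ideal.span (leadTerm mo '' (I : Set (MvPolynomial (Fin N) K)))

/-- The Gröbner cone `C_≺(I)`. -/
noncomputable def gCone (mo : MonoOrder N) (I : Ideal (MvPolynomial (Fin N) K)) :
    Set (Fin N → ℝ) :=
  closure {ω | (∀ i, 0 ≤ ω i) ∧ ltIdealW ω I = ltIdealO mo I}

/-- `G` is the normed reduced Gröbner basis of `I` w.r.t. `mo`. -/
def IsRedGB (mo : MonoOrder N) (I : Ideal (MvPolynomial (Fin N) K))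
    (G : Set (MvPolynomial (Fin N) K)) : Prop :=
  G.Finite ∧ G ⊆ (I : Set (MvPolynomial (Fin N) K)) ∧
  Ideal.span (leadTerm mo '' G) = ltIdealO mo I ∧
  (∀ g ∈ G, g ≠ 0 ∧ g.coeff (leadExp mo g) = 1) ∧
  (∀ g ∈ G, ∀ h ∈ G, g ≠ h → ∀ d ∈ h.support, ¬ leadExp mo g ≤ d)

/-- `mo` is an `I`-specific elimination order for the last variables:
every element of the reduced Gröbner basis whose leading term lies in `K[X]`
lies itself in `K[X]`. -/
def IsEO (n : ℕ) (mo : MonoOrder N) (I : Ideal (MvPolynomial (Fin N) K)) : Prop :=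
  ∀ G : Set (MvPolynomial (Fin N) K), IsRedGB mo I G →
    ∀ g ∈ G, inKX n (leadTerm mo g) → inKX n g

/-- `ω` is an `I`-specific elimination vector. -/
def IsEV (n : ℕ) (I : Ideal (MvPolynomial (Fin N) K)) (ω : Fin N → ℝ) : Prop :=
  (∀ i, 0 ≤ ω i) ∧ ∃ mo : MonoOrder N, IsEO n mo I ∧ ω ∈ gCone mo I

/-- The monomial order `mo` refines the weight vector `ω`. -/
def Refines (mo : MonoOrder N) (ω : Fin N → ℝ) : Prop :=
  ∀ d e : Fin N →₀ ℕ, wdeg ω ⇑d < wdeg ω ⇑e → mo.lt d e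

/-- `Ω_u`: the set of weight vectors vanishing on the first `n` coordinates. -/
def OmegaU (n N : ℕ) : Set (Fin N → ℝ) :=
  {ω | (∀ i, 0 ≤ ω i) ∧ ∀ i : Fin N, (i : ℕ) < n → ω i = 0}

/-- `L_{X,≺}(G)`: the elements of `G` whose leading term lies in `K[X]`. -/
def LXset (n : ℕ) (mo : MonoOrder N) (G : Set (MvPolynomial (Fin N) K)) :
    Set (MvPolynomial (Fin N) K) :=
  {p ∈ G | inKX n (leadTerm mo p)}
lemma castAdd_inj (n m : ℕ) : Function.Injective (Fin.castAdd m : Fin n → Fin (n + m)) := by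
  intro a b h
  exact Fin.ext (by simpa using congrArg Fin.val h)

/-- Extend an exponent vector on the first `n` variables to all `n + m` variables. -/
noncomputable def extExp (n m : ℕ) (a : Fin n →₀ ℕ) : Fin (n + m) →₀ ℕ :=
  Finsupp.mapDomain (Fin.castAdd m) a

/-- The restriction of a monomial order on `K[X][U]` to the monomials of `K[X]`. -/
noncomputable def restrictOrder (n m : ℕ) (mo : MonoOrder (n + m)) : MonoOrder n where
  lt a b := mo.lt (extExp n m a) (extExp n m b)
  total a b := by
    rcases mo.total (extExp n m a) (extExp n m b) with h | h | h
    · exact Or.inl (Finsupp.mapDomain_injective (castAdd_inj n m) h)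
    · exact Or.inr (Or.inl h)
    · exact Or.inr (Or.inr h)
  trans a b c hab hbc := mo.trans _ _ _ hab hbc
  irrefl a := mo.irrefl _
  add_right a b c h := by
    show mo.lt (extExp n m (a + c)) (extExp n m (b + c))
    rw [show extExp n m (a + c) = extExp n m a + extExp n m c from Finsupp.mapDomain_add,
        show extExp n m (b + c) = extExp n m b + extExp n m c from Finsupp.mapDomain_add]
    exact mo.add_right _ _ _ h
  zero_lt a ha := by
    show mo.lt (extExp n m 0) (extExp n m a)
    have h0 : extExp n m (0 : Fin n →₀ ℕ) = 0 := Finsupp.mapDomain_zero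
    rw [h0]
    refine mo.zero_lt _ (fun h => ha ?_)
    exact Finsupp.mapDomain_injective (castAdd_inj n m) (h.trans h0.symm)

/-- The projection `K[X][U] → K[X]` sending each `u`-variable to `0`;
on polynomials of `K[X]` it inverts the canonical inclusion `K[X] → K[X][U]`. -/
noncomputable def projX (n m : ℕ) (K : Type*) [Field K] :
    MvPolynomial (Fin (n + m)) K →ₐ[K] MvPolynomial (Fin n) K :=
  aeval (fun i : Fin (n + m) => if h : (i : ℕ) < n then X ⟨(i : ℕ), h⟩ else 0)

/-- The elimination ideal `I ∩ K[X]`, viewed as an ideal of `K[x_1,…,x_n]` via the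
canonical inclusion `K[X] → K[X][U]`. -/
noncomputable def elimIdeal (n m : ℕ) {K : Type*} [Field K]
    (I : Ideal (MvPolynomial (Fin (n + m)) K)) : Ideal (MvPolynomial (Fin n) K) :=
  Ideal.comap
    (rename (Fin.castAdd m) : MvPolynomial (Fin n) K →ₐ[K] MvPolynomial (Fin (n + m)) K) I

/-- Priority of the variables for the lex order `u_1 ≻ … ≻ u_m ≻ x_1 ≻ … ≻ x_n`
(smaller priority value = more significant variable). -/
def uPrio (n m : ℕ) (i : Fin (n + m)) : ℕ :=
  if (i : ℕ) < n then m + (i : ℕ) else (i : ℕ) - n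

/-- The pure lexicographic order with `u_1 ≻ … ≻ u_m ≻ x_1 ≻ … ≻ x_n`:
`a <_lex b` iff at the most significant position where they differ, `a` is smaller. -/
def uLexLt (n m : ℕ) (a b : Fin (n + m) →₀ ℕ) : Prop :=
  ∃ i : Fin (n + m), a i < b i ∧ ∀ j : Fin (n + m), uPrio n m j < uPrio n m i → a j = b j

/-- A nonempty finite set of exponents has a greatest element for a monomial order. -/
lemma MonoOrder.exists_greatest {N : ℕ} (mo : MonoOrder N) {s : Finset (Fin N →₀ ℕ)}
    (hs : s.Nonempty) : ∃ d ∈ s, ∀ e ∈ s, e ≠ d → mo.lt e d := by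
  induction hs using Finset.Nonempty.cons_induction with
  | singleton a => exact ⟨a, by simp, fun e he hne => absurd (by simpa using he) hne⟩
  | cons a s ha _ ih =>
    obtain ⟨d, hd, hmax⟩ := ih
    rcases mo.total a d with rfl | h | h
    · exact absurd hd ha
    · refine ⟨d, Finset.mem_cons_of_mem hd, fun e he hne => ?_⟩
      rcases Finset.mem_cons.1 he with rfl | he
      · exact h
      · exact hmax e he hne
    · refine ⟨a, Finset.mem_cons_self a s, fun e he hne => ?_⟩
      rcases Finset.mem_cons.1 he with rfl | he
      · exact absurd rfl hne
      · by_cases hed : e = d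
        · exact hed ▸ h
        · exact mo.trans _ _ _ (hmax e he hed) h

lemma leadExp_spec {N : ℕ} {K : Type*} [Field K] (mo : MonoOrder N)
    {p : MvPolynomial (Fin N) K} (hp : p ≠ 0) :
    leadExp mo p ∈ p.support ∧ ∀ e ∈ p.support, e ≠ leadExp mo p → mo.lt e (leadExp mo p) := by
  have h := mo.exists_greatest (Finset.nonempty_iff_ne_empty.2 (mt support_eq_empty.1 hp))
  rw [leadExp, dif_pos h]
  exact h.choose_spec

lemma leadExp_eq {N : ℕ} {K : Type*} [Field K] (mo : MonoOrder N)
    {p : MvPolynomial (Fin N) K} {d : Fin N →₀ ℕ} (hd : d ∈ p.support)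
    (hmax : ∀ e ∈ p.support, e ≠ d → mo.lt e d) : leadExp mo p = d := by
  have hp : p ≠ 0 := by
    rintro rfl
    simp at hd
  obtain ⟨hmem, hmax'⟩ := leadExp_spec mo hp
  by_contra hne
  exact mo.irrefl _ (mo.trans _ _ _ (hmax _ hmem hne) (hmax' d hd (Ne.symm hne)))

lemma leadTerm_zero {N : ℕ} {K : Type*} [Field K] (mo : MonoOrder N) :
    leadTerm mo (0 : MvPolynomial (Fin N) K) = 0 := by
  simp [leadTerm]

lemma mem_support_rename_castAdd {n m : ℕ} {K : Type*} [Field K]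
    {p : MvPolynomial (Fin n) K} {d : Fin (n + m) →₀ ℕ} :
    d ∈ (rename (Fin.castAdd m) p).support ↔ ∃ a ∈ p.support, extExp n m a = d := by
  classical
  rw [support_rename_of_injective (castAdd_inj n m), Finset.mem_image]
  rfl

lemma extExp_apply_castAdd {n m : ℕ} (a : Fin n →₀ ℕ) (i : Fin n) :
    extExp n m a (Fin.castAdd m i) = a i :=
  Finsupp.mapDomain_apply (castAdd_inj n m) a i

lemma extExp_apply_of_le {n m : ℕ} (a : Fin n →₀ ℕ) (i : Fin (n + m)) (hi : n ≤ (i : ℕ)) :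
    extExp n m a i = 0 := by
  refine Finsupp.mapDomain_of_notMem_range a i ?_
  rintro ⟨j, rfl⟩
  exact absurd j.2 (not_lt.2 (by simpa using hi))

lemma extExp_le_extExp_iff {n m : ℕ} {a b : Fin n →₀ ℕ} :
    extExp n m a ≤ extExp n m b ↔ a ≤ b := by
  refine ⟨fun h i => by simpa only [extExp_apply_castAdd] using h (Fin.castAdd m i), fun h i => ?_⟩
  by_cases hi : n ≤ (i : ℕ)
  · rw [extExp_apply_of_le a i hi, extExp_apply_of_le b i hi]
  · have hcast : i = Fin.castAdd m ⟨i, not_le.1 hi⟩ := rfl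
    rw [hcast, extExp_apply_castAdd, extExp_apply_castAdd]
    exact h _

lemma inKX_rename_castAdd {n m : ℕ} {K : Type*} [Field K] (p : MvPolynomial (Fin n) K) :
    inKX n (rename (Fin.castAdd m) p) := by
  intro d hd i hi
  obtain ⟨a, -, rfl⟩ := mem_support_rename_castAdd.1 hd
  exact extExp_apply_of_le a i hi

lemma exists_rename_castAdd_eq {n m : ℕ} {K : Type*} [Field K]
    {g : MvPolynomial (Fin (n + m)) K} (hg : inKX n g) :
    ∃ p : MvPolynomial (Fin n) K, rename (Fin.castAdd m) p = g := by
  refine exists_rename_eq_of_vars_subset_range g _ (castAdd_inj n m) fun i hi => ?_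
  obtain ⟨d, hd, hid⟩ := (mem_vars_iff_mem_support i).1 hi
  by_cases hin : n ≤ (i : ℕ)
  · exact absurd (hg d hd i hin) (Finsupp.mem_support_iff.1 hid)
  · exact ⟨⟨i, not_le.1 hin⟩, rfl⟩

lemma projX_rename_castAdd {n m : ℕ} {K : Type*} [Field K] (p : MvPolynomial (Fin n) K) :
    projX n m K (rename (Fin.castAdd m) p) = p := by
  have h : (projX n m K).comp (rename (Fin.castAdd m)) = AlgHom.id K _ := by
    ext i : 1
    simp [projX]
  exact DFunLike.congr_fun h p

lemma projX_image_setOf_inKX {n m : ℕ} {K : Type*} [Field K]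
    (G : Set (MvPolynomial (Fin (n + m)) K)) :
    projX n m K '' {g ∈ G | inKX n g} = {p | rename (Fin.castAdd m) p ∈ G} := by
  ext p
  constructor
  · rintro ⟨g, ⟨hgG, hg⟩, rfl⟩
    obtain ⟨q, rfl⟩ := exists_rename_castAdd_eq hg
    rwa [Set.mem_ofPred_eq, projX_rename_castAdd]
  · exact fun hp => ⟨_, ⟨hp, inKX_rename_castAdd p⟩, projX_rename_castAdd p⟩

lemma leadExp_rename_castAdd {n m : ℕ} {K : Type*} [Field K] (mo : MonoOrder (n + m))
    {p : MvPolynomial (Fin n) K} (hp : p ≠ 0) :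
    leadExp mo (rename (Fin.castAdd m) p) = extExp n m (leadExp (restrictOrder n m mo) p) := by
  obtain ⟨hmem, hmax⟩ := leadExp_spec (restrictOrder n m mo) hp
  refine leadExp_eq mo (mem_support_rename_castAdd.2 ⟨_, hmem, rfl⟩) fun e he hne => ?_
  obtain ⟨a, ha, rfl⟩ := mem_support_rename_castAdd.1 he
  exact hmax a ha fun h => hne (h ▸ rfl)

/-- The leading exponent of a nonzero element of `I` is divisible by the leading exponent of
some element of a reduced Gröbner basis of `I`. -/
lemma IsRedGB.exists_leadExp_le {N : ℕ} {K : Type*} [Field K] {mo : MonoOrder N}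
    {I : Ideal (MvPolynomial (Fin N) K)} {G : Set (MvPolynomial (Fin N) K)}
    (hG : IsRedGB mo I G) {f : MvPolynomial (Fin N) K} (hfI : f ∈ I) (hf : f ≠ 0) :
    ∃ g ∈ G, leadExp mo g ≤ leadExp mo f := by
  obtain ⟨-, -, hspan, hnorm, -⟩ := hG
  have himage : leadTerm mo '' G = (fun d => monomial d (1 : K)) '' (leadExp mo '' G) := by
    rw [Set.image_image]
    exact Set.image_congr fun g hg => by rw [leadTerm, (hnorm g hg).2]
  have hmem : leadTerm mo f ∈ ltIdealO mo I := Ideal.subset_span ⟨f, hfI, rfl⟩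
  rw [← hspan, himage, mem_ideal_span_monomial_image] at hmem
  have hsupp : leadExp mo f ∈ (leadTerm mo f).support := by
    have hcoeff := mem_support_iff.1 (leadExp_spec mo hf).1
    rw [mem_support_iff, leadTerm, coeff_monomial, if_pos rfl]
    exact hcoeff
  obtain ⟨_, ⟨g, hg, rfl⟩, hle⟩ := hmem _ hsupp
  exact ⟨g, hg, hle⟩

/-- If `≺` is an `I`-specific elimination order for `U`, then
`GB(I,≺) ∩ K[X]` (transported to `K[x_1,…,x_n]`) is the normed reduced Gröbner basis of
the elimination ideal `I ∩ K[X]` w.r.t. the restriction of `≺` to monomials of `K[X]`. -/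
theorem elim_redGB_of_EO (n m : ℕ) {K : Type*} [Field K]
    (mo : MonoOrder (n + m))
    (I : Ideal (MvPolynomial (Fin (n + m)) K))
    (hEO : IsEO n mo I)
    (G : Set (MvPolynomial (Fin (n + m)) K)) (hG : IsRedGB mo I G) :
    IsRedGB (restrictOrder n m mo) (elimIdeal n m I)
      (projX n m K '' {g ∈ G | inKX n g}) := by
  have hinj := rename_injective (R := K) _ (castAdd_inj n m)
  have hne : ∀ p : MvPolynomial (Fin n) K, rename (Fin.castAdd m) p ∈ G → p ≠ 0 := by
    rintro p hp rfl
    exact (hG.2.2.2.1 _ hp).1 (map_zero _)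
  have hcoeff : ∀ p : MvPolynomial (Fin n) K, rename (Fin.castAdd m) p ∈ G →
      p.coeff (leadExp (restrictOrder n m mo) p) = 1 := by
    intro p hp
    have h := (hG.2.2.2.1 _ hp).2
    rwa [leadExp_rename_castAdd mo (hne p hp), extExp,
      coeff_rename_mapDomain _ (castAdd_inj n m)] at h
  rw [projX_image_setOf_inKX]
  refine ⟨hG.1.preimage hinj.injOn, fun p hp => hG.2.1 hp, le_antisymm ?_ ?_,
    fun p hp => ⟨hne p hp, hcoeff p hp⟩, fun p hp q hq hpq d hd hle => ?_⟩
  · exact Ideal.span_mono (Set.image_mono fun p hp => hG.2.1 hp)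
  · rw [ltIdealO, Ideal.span_le]
    rintro _ ⟨f, hf, rfl⟩
    by_cases hf0 : f = 0
    · rw [hf0, leadTerm_zero]
      exact zero_mem _
    obtain ⟨g, hg, hle⟩ := hG.exists_leadExp_le hf ((map_ne_zero_iff _ hinj).2 hf0)
    rw [leadExp_rename_castAdd mo hf0] at hle
    have hgX : inKX n g := by
      refine hEO G hG g hg fun d hd i hi => ?_
      rw [Finset.mem_singleton.1 (support_monomial_subset hd)]
      exact Nat.le_zero.1 ((hle i).trans_eq (extExp_apply_of_le _ i hi))
    obtain ⟨p, rfl⟩ := exists_rename_castAdd_eq hgX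
    rw [leadExp_rename_castAdd mo (hne p hg), extExp_le_extExp_iff] at hle
    have hdvd : leadTerm (restrictOrder n m mo) p ∣ leadTerm (restrictOrder n m mo) f := by
      rw [leadTerm, leadTerm, hcoeff p hg, monomial_dvd_monomial]
      exact ⟨Or.inr hle, one_dvd _⟩
    exact Ideal.mem_of_dvd _ hdvd (Ideal.subset_span ⟨p, hg, rfl⟩)
  · refine hG.2.2.2.2 _ hp _ hq (hinj.ne hpq) (extExp n m d)
      (mem_support_rename_castAdd.2 ⟨d, hd, rfl⟩) ?_
    rw [leadExp_rename_castAdd mo (hne p hp)]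
    exact extExp_le_extExp_iff.2 hle
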